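/- arXiv:2301.02205 — 4 statements merged into one kernel-verified Lean document; each statement's English description precedes it below -/
import Mathlib

section
/- Let S be a meet-semilattice with least element 0 satisfying the ascending chain condition and let a, b ∈ S. Then a ∧ (a ∧ b)⁰ ≈₁ a ∧ b⁰, i.e. the sets {a ∧ z | z ∈ (a ∧ b)⁰} and {a ∧ z | z ∈ b⁰} satisfy A ≤₁ B and B ≤₁ A. -/
/-- The set of maximal elements of `A`. -/
def MaxSet {S : Type*} [PartialOrder S] (A : Set S) : Set S :=
  {m | m ∈ A ∧ ∀ x ∈ A, m ≤ x → x = m}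

/-- The ascending chain condition, stated as: every nonempty subset has a maximal element. -/
def AccMax (S : Type*) [PartialOrder S] : Prop :=
  ∀ A : Set S, A.Nonempty → (MaxSet A).Nonempty

/-- Unsharp negation: `a⁰ = Max {x | a ⊓ x = ⊥}`. -/
def UNeg {S : Type*} [SemilatticeInf S] [OrderBot S] (a : S) : Set S :=
  MaxSet {x | a ⊓ x = ⊥}

/-- Unsharp implication: `a → b = Max {x | a ⊓ x ≤ b}`. -/
def UImp {S : Type*} [SemilatticeInf S] (a b : S) : Set S :=
  MaxSet {x | a ⊓ x ≤ b}

/-- `A ≤₁ B` : every element of `A` lies below some element of `B`. -/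
def Le1 {S : Type*} [Preorder S] (A B : Set S) : Prop :=
  ∀ a ∈ A, ∃ b ∈ B, a ≤ b

/-- `A ≈₁ B` : `A ≤₁ B` and `B ≤₁ A`. -/
def Approx1 {S : Type*} [Preorder S] (A B : Set S) : Prop :=
  Le1 A B ∧ Le1 B A

/-- Elementwise meet of two sets: `A ∧ B = {a ⊓ b | a ∈ A, b ∈ B}`. -/
def MeetSet {S : Type*} [SemilatticeInf S] (A B : Set S) : Set S :=
  {c | ∃ a ∈ A, ∃ b ∈ B, c = a ⊓ b}

theorem AccMax.exists_le_mem_maxSet {S : Type*} [PartialOrder S] (hacc : AccMax S)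
    {A : Set S} {x : S} (hx : x ∈ A) : ∃ z ∈ MaxSet A, x ≤ z := by
  obtain ⟨m, ⟨hmA, hxm⟩, hmax⟩ := hacc {y | y ∈ A ∧ x ≤ y} ⟨x, hx, le_rfl⟩
  exact ⟨m, ⟨hmA, fun y hy hmy => hmax y ⟨hy, hxm.trans hmy⟩ hmy⟩, hxm⟩

theorem AccMax.le1_meetSet_uNeg {S : Type*} [SemilatticeInf S] [OrderBot S] (hacc : AccMax S)
    {a b c : S} (h : ∀ z, b ⊓ z = ⊥ → c ⊓ (a ⊓ z) = ⊥) :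
    Le1 (MeetSet {a} (UNeg b)) (MeetSet {a} (UNeg c)) := by
  rintro _ ⟨_, rfl, z, hz, rfl⟩
  obtain ⟨w, hw, hzw⟩ := hacc.exists_le_mem_maxSet (A := {x | c ⊓ x = ⊥}) (h z hz.1)
  exact ⟨_, ⟨_, rfl, w, hw, rfl⟩, le_inf inf_le_left hzw⟩

theorem stmt6 {S : Type*} [SemilatticeInf S] [OrderBot S] (hacc : AccMax S) (a b : S) :
    Approx1 (MeetSet {a} (UNeg (a ⊓ b))) (MeetSet {a} (UNeg b)) := by
  refine ⟨hacc.le1_meetSet_uNeg fun z hz => ?_, hacc.le1_meetSet_uNeg fun z hz => ?_⟩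
  · rwa [← inf_assoc, inf_comm b a]
  · rw [inf_inf_inf_comm, hz, inf_bot_eq]
end

section
/- Let S be a meet-semilattice with least element 0 satisfying the ascending chain condition and let x, y ∈ S. Then x⁰ ∧ y⁰ ≤₁ (x ∧ y)⁰, i.e. for all u ∈ x⁰ and v ∈ y⁰ there exists w ∈ (x ∧ y)⁰ with u ∧ v ≤ w. -/
/-- Under the ascending chain condition, every element of `A` lies below a maximal one. -/
theorem AccMax.exists_maxSet_ge {S : Type*} [PartialOrder S] (hacc : AccMax S) {A : Set S} {a : S}
    (ha : a ∈ A) : ∃ m ∈ MaxSet A, a ≤ m := by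
  obtain ⟨m, ⟨hmA, ham⟩, hmax⟩ := hacc {x | x ∈ A ∧ a ≤ x} ⟨a, ha, le_rfl⟩
  exact ⟨m, ⟨hmA, fun x hx hmx => hmax x ⟨hx, ham.trans hmx⟩ hmx⟩, ham⟩

theorem stmt7 {S : Type*} [SemilatticeInf S] [OrderBot S] (hacc : AccMax S) (x y : S) :
    Le1 (MeetSet (UNeg x) (UNeg y)) (UNeg (x ⊓ y)) := by
  rintro _ ⟨u, hu, v, -, rfl⟩
  have hxu : x ⊓ u = ⊥ := hu.1
  exact hacc.exists_maxSet_ge (A := {z | x ⊓ y ⊓ z = ⊥})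
    (le_bot_iff.mp (hxu ▸ inf_le_inf inf_le_left inf_le_left))
end

section
/- Let S be a meet-semilattice with least element 0 satisfying the ascending chain condition and let a, b, c ∈ S. Then a → (b ∧ c) ≈₁ (a → b) ∧ (a → c), i.e. the sets a → (b ∧ c) and {u ∧ v | u ∈ a → b, v ∈ a → c} satisfy A ≤₁ B and B ≤₁ A. -/
theorem AccMax.exists_mem_maxSet_ge {S : Type*} [PartialOrder S] (hacc : AccMax S)
    {A : Set S} {x : S} (hx : x ∈ A) : ∃ m ∈ MaxSet A, x ≤ m := by
  obtain ⟨m, ⟨hmA, hxm⟩, hmax⟩ := hacc {y | y ∈ A ∧ x ≤ y} ⟨x, hx, le_rfl⟩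
  exact ⟨m, ⟨hmA, fun y hy hmy => hmax y ⟨hy, hxm.trans hmy⟩ hmy⟩, hxm⟩

theorem AccMax.exists_mem_uImp_ge {S : Type*} [SemilatticeInf S] (hacc : AccMax S)
    {a b x : S} (hx : a ⊓ x ≤ b) : ∃ m ∈ UImp a b, x ≤ m :=
  hacc.exists_mem_maxSet_ge (A := {x | a ⊓ x ≤ b}) hx

theorem stmt14 {S : Type*} [SemilatticeInf S] [OrderBot S] (hacc : AccMax S)
    (a b c : S) :
    Approx1 (UImp a (b ⊓ c)) (MeetSet (UImp a b) (UImp a c)) := by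
  constructor
  · rintro m ⟨hm, -⟩
    obtain ⟨u, hu, hmu⟩ := hacc.exists_mem_uImp_ge (le_trans hm inf_le_left)
    obtain ⟨v, hv, hmv⟩ := hacc.exists_mem_uImp_ge (le_trans hm inf_le_right)
    exact ⟨u ⊓ v, ⟨u, hu, v, hv, rfl⟩, le_inf hmu hmv⟩
  · rintro _ ⟨u, ⟨hu, -⟩, v, ⟨hv, -⟩, rfl⟩
    exact hacc.exists_mem_uImp_ge
      (le_inf ((inf_le_inf_left a inf_le_left).trans hu)
        ((inf_le_inf_left a inf_le_right).trans hv))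
end

section
/- Let S be a meet-semilattice with least element 0 satisfying the ascending chain condition and let a, b, c ∈ S. Then a ∧ b ≤ c if and only if a ≤₁ b → c, i.e. a ∧ b ≤ c holds exactly when there exists z ∈ b → c with a ≤ z (unsharp adjointness). -/
theorem stmt17 {S : Type*} [SemilatticeInf S] [OrderBot S] (hacc : AccMax S)
    (a b c : S) : a ⊓ b ≤ c ↔ ∃ z ∈ UImp b c, a ≤ z := by
  constructor
  · intro h
    obtain ⟨m, ⟨hm, ham⟩, hmax⟩ := hacc {x | b ⊓ x ≤ c ∧ a ≤ x} ⟨a, by rwa [inf_comm] at h, le_rfl⟩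
    exact ⟨m, ⟨hm, fun x hx hmx => hmax x ⟨hx, ham.trans hmx⟩ hmx⟩, ham⟩
  · rintro ⟨z, ⟨hz, -⟩, haz⟩
    exact (le_inf inf_le_right (inf_le_left.trans haz)).trans hz
end
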